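/- arXiv:1708.02855 — 2 statements merged into one kernel-verified Lean document; each statement's English description precedes it below -/
import Mathlib

section
/- Let M be a Peano continuum and let G be a group acting on M as a geometrically finite convergence group. Then the set M*(3+) is partitioned by the relation ≈ into classes each consisting of exactly two points, and no two of these pairs mutually separate. -/
open Set Pointwise

/-- A generalized Peano continuum: a connected, locally compact, locally connected,
σ-compact, metrizable topological space. -/
structure IsGenPeanoContinuum (X : Type*) [TopologicalSpace X] : Prop where
  connectedSpace : ConnectedSpace X
  locallyCompactSpace : LocallyCompactSpace X
  locallyConnectedSpace : LocallyConnectedSpace X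
  sigmaCompactSpace : SigmaCompactSpace X
  metrizableSpace : TopologicalSpace.MetrizableSpace X

/-- An exhaustion of a space by compact sets. -/
structure IsExhaustion {X : Type*} [TopologicalSpace X] (C : ℕ → Set X) : Prop where
  isCompact : ∀ i, IsCompact (C i)
  subset_interior : ∀ i, C i ⊆ interior (C (i + 1))
  iUnion_eq : (⋃ i, C i) = Set.univ

/-- The space of ends of `X` with respect to the exhaustion `C`: the inverse limit of the
sets of connected components of the complements `X ∖ C i`, the bonding maps being induced
by inclusion. -/
def EndsSpace {X : Type*} [TopologicalSpace X] (C : ℕ → Set X) : Type _ :=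
  { E : ℕ → Set X //
      (∀ i, ∃ x ∈ (C i)ᶜ, E i = connectedComponentIn (C i)ᶜ x) ∧
        ∀ i, E (i + 1) ⊆ E i }

/-- `EndsSpace C` is topologized as a subspace of the product of the discrete spaces of
components. -/
instance EndsSpace.instTopologicalSpace {X : Type*} [TopologicalSpace X] (C : ℕ → Set X) :
    TopologicalSpace (EndsSpace C) :=
  TopologicalSpace.induced (fun E => (E.1 : ℕ → Set X))
    (@Pi.topologicalSpace ℕ (fun _ => Set X) fun _ => ⊥)

/-- `G` acts on `X` by homeomorphisms. -/
def ContinuousActionOn (G X : Type*) [Group G] [TopologicalSpace X] [MulAction G X] : Prop :=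
  ∀ g : G, Continuous fun x : X => g • x

/-- The action of `G` on `X` is proper: for every compact `K`, only finitely many translates
of `K` meet `K`. -/
def ProperActionOn (G X : Type*) [Group G] [TopologicalSpace X] [MulAction G X] : Prop :=
  ∀ K : Set X, IsCompact K → {g : G | ((g • K) ∩ K).Nonempty}.Finite

/-- The action of `G` on `X` is cocompact: the translates of some compact set cover `X`. -/
def CocompactActionOn (G X : Type*) [Group G] [TopologicalSpace X] [MulAction G X] : Prop :=
  ∃ K : Set X, IsCompact K ∧ (⋃ g : G, g • K) = Set.univ

universe u

/-- `x` is a global cut point: `M ∖ {x}` is disconnected. -/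
def IsGlobalCutPoint (M : Type*) [TopologicalSpace M] (x : M) : Prop :=
  ¬ IsPreconnected ({x}ᶜ : Set M)

/-- The valence of `x` equals the cardinal `n`: `M ∖ {x}` has exactly `n` ends (with respect
to any exhaustion). -/
def valenceEq {M : Type u} [TopologicalSpace M] (x : M) (n : Cardinal.{u}) : Prop :=
  ∀ C : ℕ → Set (({x}ᶜ : Set M)), IsExhaustion C → Cardinal.mk (EndsSpace C) = n

/-- The valence of `x` is at least `n`: `M ∖ {x}` has at least `n` ends (with respect to any
exhaustion). -/
def valenceGe {M : Type u} [TopologicalSpace M] (x : M) (n : Cardinal.{u}) : Prop :=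
  ∀ C : ℕ → Set (({x}ᶜ : Set M)), IsExhaustion C → n ≤ Cardinal.mk (EndsSpace C)

/-- `x` is a local cut point: `M ∖ {x}` is disconnected, or it is connected and has more
than one end. -/
def IsLocalCutPoint (M : Type u) [TopologicalSpace M] (x : M) : Prop :=
  ¬ IsPreconnected ({x}ᶜ : Set M) ∨
    (IsPreconnected ({x}ᶜ : Set M) ∧ valenceGe x 2)

/-- The sequence `g` converges to `α` locally uniformly on `M ∖ {β}`: for every compact
`C ⊆ M ∖ {β}` and every open neighborhood `U` of `α` we eventually have `g i • C ⊆ U`. -/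
def TendstoLocallyUniformlyAway {G M : Type*} [TopologicalSpace M] [SMul G M]
    (g : ℕ → G) (α β : M) : Prop :=
  ∀ C : Set M, IsCompact C → C ⊆ {β}ᶜ →
    ∀ U : Set M, IsOpen U → α ∈ U → ∃ N : ℕ, ∀ i : ℕ, N < i → (g i) • C ⊆ U

/-- The action of `G` on `M` is a convergence action: every sequence of distinct group
elements has a subsequence `g_{k_i}` and attracting/repelling points `α, β ∈ M` with
`g_{k_i} → α` locally uniformly on `M ∖ {β}` and `g_{k_i}⁻¹ → β` locally uniformly on
`M ∖ {α}`. -/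
def IsConvergenceAction (G M : Type*) [Group G] [TopologicalSpace M] [MulAction G M] : Prop :=
  ∀ g : ℕ → G, Function.Injective g →
    ∃ (α β : M) (φ : ℕ → ℕ), StrictMono φ ∧
      TendstoLocallyUniformlyAway (fun i => g (φ i)) α β ∧
      TendstoLocallyUniformlyAway (fun i => (g (φ i))⁻¹) β α

/-- `x` is a conical limit point: there are a sequence `(g n)` in `G` and distinct points
`α, β ∈ M` with `g n • x → α` while `g n • y → β` for every `y ≠ x`. -/
def IsConicalLimitPoint (G : Type*) {M : Type*} [Group G] [TopologicalSpace M]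
    [MulAction G M] (x : M) : Prop :=
  ∃ (g : ℕ → G) (α β : M), α ≠ β ∧
    Filter.Tendsto (fun n => g n • x) Filter.atTop (nhds α) ∧
    ∀ y : M, y ≠ x → Filter.Tendsto (fun n => g n • y) Filter.atTop (nhds β)

/-- `g` is loxodromic: it has infinite order and fixes exactly two points of `M`. -/
def IsLoxodromic (G : Type*) (M : Type*) [Group G] [TopologicalSpace M] [MulAction G M]
    (g : G) : Prop :=
  ¬ IsOfFinOrder g ∧ ∃ a b : M, a ≠ b ∧ {x : M | g • x = x} = {a, b}

/-- `p` is a parabolic point: it is the unique point stabilized by some infinite subgroup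
of `G` containing no loxodromic elements. -/
def IsParabolicPoint (G : Type*) {M : Type*} [Group G] [TopologicalSpace M]
    [MulAction G M] (p : M) : Prop :=
  ∃ P : Subgroup G, (P : Set G).Infinite ∧ (∀ g ∈ P, ¬ IsLoxodromic G M g) ∧
    {x : M | ∀ g ∈ P, g • x = x} = {p}

/-- `p` is a bounded parabolic point: a parabolic point whose stabilizer acts properly and
cocompactly on `M ∖ {p}`. -/
def IsBoundedParabolicPoint (G : Type*) {M : Type*} [Group G] [TopologicalSpace M]
    [MulAction G M] (p : M) : Prop :=
  IsParabolicPoint G p ∧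
    (∀ K : Set M, K ⊆ {p}ᶜ → IsCompact K →
      {g : G | g • p = p ∧ ((g • K) ∩ K).Nonempty}.Finite) ∧
    ∃ K : Set M, K ⊆ {p}ᶜ ∧ IsCompact K ∧ (⋃ g ∈ {g : G | g • p = p}, g • K) = {p}ᶜ

/-- The action of `G` on `M` is a geometrically finite convergence action: it is a
convergence action and every point of `M` is a conical limit point or a bounded parabolic
point. -/
def IsGeometricallyFinite (G M : Type*) [Group G] [TopologicalSpace M] [MulAction G M] :
    Prop :=
  IsConvergenceAction G M ∧
    ∀ x : M, IsConicalLimitPoint G x ∨ IsBoundedParabolicPoint G x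

/-- `𝒩(a,b)`: the number of connected components of `M ∖ {a, b}`. -/
def numComplementaryComponents (M : Type u) [TopologicalSpace M] (a b : M) : Cardinal.{u} :=
  Cardinal.mk (ConnectedComponents (({a, b}ᶜ : Set M)))

/-- The pair `{c, d}` separates the points `a` and `b`: both lie in `M ∖ {c, d}`, in
distinct connected components. -/
def PairSeparatesPoints (M : Type*) [TopologicalSpace M] (c d a b : M) : Prop :=
  a ∈ ({c, d}ᶜ : Set M) ∧ b ∈ ({c, d}ᶜ : Set M) ∧
    connectedComponentIn ({c, d}ᶜ : Set M) a ≠ connectedComponentIn ({c, d}ᶜ : Set M) b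

/-- The pairs `{a, b}` and `{c, d}` mutually separate: `c, d` lie in distinct components of
`M ∖ {a, b}` and `a, b` lie in distinct components of `M ∖ {c, d}`. -/
def MutuallySeparate (M : Type*) [TopologicalSpace M] (a b c d : M) : Prop :=
  PairSeparatesPoints M a b c d ∧ PairSeparatesPoints M c d a b

/-- `M*(2)`: the set of conical limit points of valence `2` which are not global cut
points. -/
def Mstar2 (G : Type*) (M : Type u) [Group G] [TopologicalSpace M] [MulAction G M] :
    Set M :=
  {x : M | IsConicalLimitPoint G x ∧ ¬ IsGlobalCutPoint M x ∧ valenceEq x 2}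

/-- `M*(3+)`: the set of conical limit points of valence `≥ 3` which are not global cut
points. -/
def Mstar3plus (G : Type*) (M : Type u) [Group G] [TopologicalSpace M] [MulAction G M] :
    Set M :=
  {x : M | IsConicalLimitPoint G x ∧ ¬ IsGlobalCutPoint M x ∧ valenceGe x 3}

/-- The relation `∼`: `x ∼ y` iff `x = y` or `𝒩(x,y) = 2`. -/
def SimRel {M : Type u} [TopologicalSpace M] (x y : M) : Prop :=
  x = y ∨ numComplementaryComponents M x y = 2

/-- The relation `≈` on `M*(3+)`: `a ≈ b` iff `a ≠ b` and
`𝒩(a,b) = val(a) = val(b) ≥ 3`. -/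
def ApproxRel {M : Type u} [TopologicalSpace M] (a b : M) : Prop :=
  a ≠ b ∧ ∃ n : Cardinal.{u}, 3 ≤ n ∧ numComplementaryComponents M a b = n ∧
    valenceEq a n ∧ valenceEq b n

section Helpers

open Filter Topology

/-- `T` absorbs every preconnected subset of `F` that it meets. -/
def AbsorbsIn {X : Type*} [TopologicalSpace X] (F T : Set X) : Prop :=
  ∀ V : Set X, V ⊆ F → IsPreconnected V → (V ∩ T).Nonempty → V ⊆ T

lemma absorbsIn_connectedComponentIn {X : Type*} [TopologicalSpace X] (F : Set X) (y : X) :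
    AbsorbsIn F (connectedComponentIn F y) := by
  rintro V hVF hV ⟨z, hzV, hz⟩
  rw [connectedComponentIn_eq hz]
  exact hV.subset_connectedComponentIn hzV hVF

lemma AbsorbsIn.smul {G X : Type*} [Group G] [TopologicalSpace X] [MulAction G X]
    [ContinuousConstSMul G X] {F T : Set X} (h : AbsorbsIn F T) (g : G) :
    AbsorbsIn (g • F) (g • T) := by
  rintro V hVF hV ⟨z, hzV, hz⟩
  have := h (g⁻¹ • V) (by rwa [← subset_smul_set_iff])
    (hV.image _ (continuous_const_smul g⁻¹).continuousOn)
    ⟨g⁻¹ • z, smul_mem_smul_set hzV, mem_smul_set_iff_inv_smul_mem.1 hz⟩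
  rwa [← subset_smul_set_iff] at this

lemma exists_isOpen_isPreconnected_subset {X : Type*} [TopologicalSpace X]
    [LocallyConnectedSpace X] {x : X} {U : Set X} (hU : U ∈ 𝓝 x) :
    ∃ V ⊆ U, IsOpen V ∧ x ∈ V ∧ IsPreconnected V := by
  obtain ⟨V, hVU, hVo, hxV, hV⟩ :=
    locallyConnectedSpace_iff_subsets_isOpen_isConnected.1 ‹_› x U hU
  exact ⟨V, hVU, hVo, hxV, hV.isPreconnected⟩

lemma mem_closure_connectedComponentIn_diff_singleton {X : Type*} [TopologicalSpace X]
    [T1Space X] [LocallyConnectedSpace X] {V : Set X} {a q : X} (hVo : IsOpen V)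
    (hV : IsPreconnected V) (haV : a ∈ V) (hqV : q ∈ V) (hqa : q ≠ a) :
    a ∈ closure (connectedComponentIn (V \ {a}) q) := by
  by_contra hcl
  set W := connectedComponentIn (V \ {a}) q with hW
  have hFo : IsOpen (V \ {a}) := hVo.sdiff isClosed_singleton
  have hqW : q ∈ W := mem_connectedComponentIn ⟨hqV, hqa⟩
  have hsub : V ⊆ W := by
    refine hV.subset_of_closure_inter_subset hFo.connectedComponentIn ⟨q, hqV, hqW⟩ ?_
    rintro y ⟨hyW, hyV⟩
    have hya : y ≠ a := fun h => hcl (h ▸ hyW)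
    have hyo : IsOpen (connectedComponentIn (V \ {a}) y) := hFo.connectedComponentIn
    obtain ⟨z, hzy, hzW⟩ := mem_closure_iff.1 hyW _ hyo (mem_connectedComponentIn ⟨hyV, hya⟩)
    rw [hW, connectedComponentIn_eq hzW, ← connectedComponentIn_eq hzy]
    exact mem_connectedComponentIn ⟨hyV, hya⟩
  exact (connectedComponentIn_subset _ _ (hsub haV)).2 rfl

lemma absorbsIn_setOf_eventually_mem {X : Type*} [TopologicalSpace X] [LocallyConnectedSpace X]
    {l : Ultrafilter ℕ} {O : Set X} {F T : ℕ → Set X}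
    (hF : ∀ y ∈ O, ∃ U ∈ 𝓝 y, ∀ᶠ n in l, U ⊆ F n) (hT : ∀ n, AbsorbsIn (F n) (T n)) :
    AbsorbsIn O {y | ∀ᶠ n in l, y ∈ T n} := by
  set L : Set X := {y | ∀ᶠ n in l, y ∈ T n} with hL
  have key : ∀ y ∈ O, ∃ U : Set X, IsOpen U ∧ y ∈ U ∧ (∀ z ∈ U, z ∈ L → U ⊆ L) := by
    intro y hy
    obtain ⟨U, hU, hUF⟩ := hF y hy
    obtain ⟨V, hVU, hVo, hyV, hV⟩ := exists_isOpen_isPreconnected_subset hU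
    refine ⟨V, hVo, hyV, fun z hzV hzL w hw => ?_⟩
    filter_upwards [hUF, hzL] with n hn hz
    exact hT n V (hVU.trans hn) hV ⟨z, hzV, hz⟩ hw
  rintro V hVO hV ⟨z, hzV, hzL⟩
  have hsub : V ⊆ interior L := by
    refine hV.subset_of_closure_inter_subset isOpen_interior ⟨z, hzV, ?_⟩ ?_
    · obtain ⟨U, hUo, hzU, hUL⟩ := key z (hVO hzV)
      exact mem_interior.2 ⟨U, hUL z hzU hzL, hUo, hzU⟩
    · rintro y ⟨hyc, hyV⟩
      obtain ⟨U, hUo, hyU, hUL⟩ := key y (hVO hyV)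
      obtain ⟨w, hwU, hwL⟩ := mem_closure_iff.1 hyc U hUo hyU
      exact mem_interior.2 ⟨U, hUL w hwU (interior_subset hwL), hUo, hyU⟩
  exact hsub.trans interior_subset

lemma exists_mem_setOf_eventually_mem {X : Type*} [TopologicalSpace X] [LocallyConnectedSpace X]
    {l : Ultrafilter ℕ} {O S : Set X} {F T : ℕ → Set X}
    (hF : ∀ y ∈ O, ∃ U ∈ 𝓝 y, ∀ᶠ n in l, U ⊆ F n) (hT : ∀ n, AbsorbsIn (F n) (T n))
    (hS : IsCompact S) (hSO : S ⊆ O) (hTS : ∀ᶠ n in l, (T n ∩ S).Nonempty) :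
    ∃ q ∈ S, ∀ᶠ n in l, q ∈ T n := by
  have : Nonempty X := ⟨hTS.exists.choose_spec.choose⟩
  choose! q hq using fun (n : ℕ) (h : (T n ∩ S).Nonempty) => h
  obtain ⟨p, hpS, hp⟩ := hS.ultrafilter_le_nhds' (l.map q)
    (Ultrafilter.mem_map.2 (by filter_upwards [hTS] with n hn using (hq n hn).2))
  refine ⟨p, hpS, ?_⟩
  obtain ⟨U, hU, hUF⟩ := hF p (hSO hpS)
  obtain ⟨V, hVU, hVo, hpV, hV⟩ := exists_isOpen_isPreconnected_subset hU
  have hVl : ∀ᶠ n in l, q n ∈ V := hp (hVo.mem_nhds hpV)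
  filter_upwards [hTS, hUF, hVl] with n hn hUn hVn
  exact hT n V (hVU.trans hUn) hV ⟨q n, hVn, (hq n hn).1⟩ hpV

lemma IsPreconnected.inter_sphere_nonempty {X : Type*} [MetricSpace X] {T : Set X}
    (hT : IsPreconnected T) {x y a : X} {r : ℝ} (hx : x ∈ T) (hy : y ∈ T)
    (hxr : dist x a ≤ r) (hyr : r ≤ dist y a) : (T ∩ Metric.sphere a r).Nonempty := by
  obtain ⟨z, hz, hzr⟩ := hT.intermediate_value hx hy
    (f := fun z => dist z a) (by fun_prop) ⟨hxr, hyr⟩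
  exact ⟨z, hz, hzr⟩

/-- Connected sets joining `x n → α` to sets `K n` shrinking to `β ≠ α`: three of them can be
pairwise separated by `x n` and `K n` only if `x n = α` for large `n`. -/
lemma eventually_eq_of_three_components {X : Type*} [MetricSpace X] [CompactSpace X]
    [LocallyConnectedSpace X] {l : Ultrafilter ℕ} {α β : X} (hαβ : α ≠ β) {x : ℕ → X}
    (hx : Tendsto x l (𝓝 α)) {K : ℕ → Set X} (hK : ∀ U ∈ 𝓝 β, ∀ᶠ n in l, K n ⊆ U)
    {T : Fin 3 → ℕ → Set X} (hTc : ∀ j n, IsPreconnected (T j n))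
    (hTa : ∀ j n, AbsorbsIn ({x n} ∪ K n)ᶜ (T j n))
    (hTd : ∀ j k, j ≠ k → ∀ n, Disjoint (T j n) (T k n))
    (hTx : ∀ j n, x n ∈ closure (T j n)) {c : Fin 3 → ℕ → X} (hcT : ∀ j n, c j n ∈ T j n)
    (hc : ∀ j, Tendsto (c j) l (𝓝 β)) : ∀ᶠ n in l, x n = α := by
  have hF : ∀ y ∈ ({α, β}ᶜ : Set X), ∃ U ∈ 𝓝 y, ∀ᶠ n in l, U ⊆ ({x n} ∪ K n)ᶜ := by
    intro y hy
    simp only [mem_compl_iff, mem_insert_iff, mem_singleton_iff, not_or] at hy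
    obtain ⟨U₁, V₁, hU₁, hV₁, hd₁⟩ := t2_separation_nhds hy.1
    obtain ⟨U₂, V₂, hU₂, hV₂, hd₂⟩ := t2_separation_nhds hy.2
    refine ⟨U₁ ∩ U₂, inter_mem hU₁ hU₂, ?_⟩
    filter_upwards [hx hV₁, hK V₂ hV₂] with n hn₁ hn₂
    rintro z ⟨hz₁, hz₂⟩ (rfl | hz)
    · exact hd₁.notMem_of_mem_left hz₁ hn₁
    · exact hd₂.notMem_of_mem_left hz₂ (hn₂ hz)
  have hpos : 0 < dist β α := dist_pos.2 hαβ.symm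
  obtain ⟨V, hVb, hVo, hαV, hV⟩ :=
    exists_isOpen_isPreconnected_subset (Metric.ball_mem_nhds α (half_pos hpos))
  obtain ⟨ε, hε, hεV⟩ := Metric.isOpen_iff.1 hVo α hαV
  set r := min (ε / 2) (dist β α / 2) with hr
  have hr0 : 0 < r := lt_min (half_pos hε) (half_pos hpos)
  have hrβ : r < dist β α := (min_le_right _ _).trans_lt (half_lt_self hpos)
  have hSV : Metric.sphere α r ⊆ V := fun z hz => hεV <| by
    rw [Metric.mem_ball, Metric.mem_sphere.1 hz]
    exact (min_le_left _ _).trans_lt (half_lt_self hε)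
  have hVK : ∀ᶠ n in l, Disjoint V (K n) := by
    filter_upwards [hK _ (Metric.ball_mem_nhds β (half_pos hpos))] with n hn
    refine Set.disjoint_left.2 fun z hzV hzK => ?_
    have h1 := Metric.mem_ball.1 (hVb hzV)
    have h2 := Metric.mem_ball.1 (hn hzK)
    linarith [dist_triangle_left β α z]
  have hβV : β ∉ V := fun h => by
    have h1 := Metric.mem_ball.1 (hVb h)
    linarith
  have hVO : V \ {α} ⊆ ({α, β}ᶜ : Set X) := by
    rintro z ⟨hzV, hzα⟩ (rfl | rfl)
    exacts [hzα rfl, hβV hzV]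
  have hSα : Metric.sphere α r ⊆ V \ {α} := fun z hz => ⟨hSV hz, fun h => by
    rw [mem_singleton_iff.1 h, Metric.mem_sphere, dist_self] at hz
    exact hr0.ne hz⟩
  have hq : ∀ j, ∃ q ∈ Metric.sphere α r, ∀ᶠ n in l, q ∈ T j n := by
    intro j
    refine exists_mem_setOf_eventually_mem hF (hTa j) (isCompact_sphere α r)
      (hSα.trans hVO) ?_
    have h2 : ∀ᶠ n in l, r < dist (c j n) α :=
      (((hc j).dist tendsto_const_nhds).eventually (lt_mem_nhds hrβ))
    filter_upwards [hx (Metric.ball_mem_nhds α hr0), h2] with n hn1 hn2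
    obtain ⟨y, hy, hyT⟩ := mem_closure_iff.1 (hTx j n) _ Metric.isOpen_ball hn1
    exact (hTc j n).inter_sphere_nonempty hyT (hcT j n) (Metric.mem_ball.1 hy).le hn2.le
  choose q hqS hqT using hq
  set W : Fin 3 → Set X := fun j => connectedComponentIn (V \ {α}) (q j) with hWdef
  have hqW : ∀ j, q j ∈ W j := fun j => mem_connectedComponentIn (hSα (hqS j))
  have hWV : ∀ j, W j ⊆ V \ {α} := fun j => connectedComponentIn_subset _ _
  have hWL : ∀ j, W j ⊆ {y | ∀ᶠ n in l, y ∈ T j n} := fun j =>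
    absorbsIn_setOf_eventually_mem hF (hTa j) _ ((hWV j).trans hVO)
      isPreconnected_connectedComponentIn ⟨q j, hqW j, hqT j⟩
  have hWd : ∀ j k, j ≠ k → Disjoint (W j) (W k) := fun j k hjk =>
    Set.disjoint_left.2 fun z hzj hzk => by
      obtain ⟨n, hn1, hn2⟩ := ((hWL j hzj).and (hWL k hzk)).exists
      exact (hTd j k hjk n).notMem_of_mem_left hn1 hn2
  have hWα : ∀ j, IsPreconnected (insert α (W j)) := fun j =>
    isPreconnected_connectedComponentIn.subset_closure (subset_insert _ _)
      (insert_subset (mem_closure_connectedComponentIn_diff_singleton hVo hV hαV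
        (hSα (hqS j)).1 (hSα (hqS j)).2) subset_closure)
  filter_upwards [hVK, eventually_all.2 hqT] with n hn hqn
  by_contra hne
  have key : ∀ j k, j ≠ k → x n ∉ W j → x n ∉ W k → False := by
    intro j k hjk hj hk
    have hZ : IsPreconnected (insert α (W j) ∪ insert α (W k)) :=
      (hWα j).union α (mem_insert _ _) (mem_insert _ _) (hWα k)
    have hZV : insert α (W j) ∪ insert α (W k) ⊆ V :=
      union_subset (insert_subset hαV ((hWV j).trans sdiff_subset))
        (insert_subset hαV ((hWV k).trans sdiff_subset))
    have hZT := hTa j n _ (by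
      rintro z hz (rfl | hzK)
      · rcases hz with (h | h) | (h | h)
        exacts [hne h, hj h, hne h, hk h]
      · exact hn.notMem_of_mem_left (hZV hz) hzK) hZ
      ⟨q j, Or.inl (Or.inr (hqW j)), hqn j⟩
    exact (hTd j k hjk n).notMem_of_mem_left (hZT (Or.inr (Or.inr (hqW k)))) (hqn k)
  by_cases h0 : x n ∈ W 0
  · exact key 1 2 (by decide) ((hWd 0 1 (by decide)).notMem_of_mem_left h0)
      ((hWd 0 2 (by decide)).notMem_of_mem_left h0)
  · by_cases h1 : x n ∈ W 1
    · exact key 0 2 (by decide) h0 ((hWd 1 2 (by decide)).notMem_of_mem_left h1)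
    · exact key 0 1 (by decide) h0 h1

lemma TendstoLocallyUniformlyAway.tendsto {G M : Type*} [TopologicalSpace M] [SMul G M]
    {g : ℕ → G} {α β y : M} (h : TendstoLocallyUniformlyAway g α β) (hy : y ≠ β) :
    Tendsto (fun n => g n • y) atTop (𝓝 α) := by
  refine tendsto_nhds.2 fun U hU hα => ?_
  obtain ⟨N, hN⟩ := h {y} isCompact_singleton (singleton_subset_iff.2 hy) U hU hα
  filter_upwards [eventually_gt_atTop N] with n hn
  exact hN n hn (smul_mem_smul_set rfl)

/-- The sequence `f` fixes `a ≠ b`, and contracts `M ∖ {a}` to `b` and, inverted, `M ∖ {b}`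
to `a`. -/
structure IsLoxodromicSequence {G M : Type*} [Group G] [TopologicalSpace M] [MulAction G M]
    (f : ℕ → G) (a b : M) : Prop where
  ne : a ≠ b
  smul_left : ∀ n, f n • a = a
  smul_right : ∀ n, f n • b = b
  tendsto : TendstoLocallyUniformlyAway f b a
  tendsto_inv : TendstoLocallyUniformlyAway (fun n => (f n)⁻¹) a b

namespace IsLoxodromicSequence

variable {G M : Type*} [Group G] [TopologicalSpace M] [MulAction G M] {f : ℕ → G} {a b : M}

lemma symm (h : IsLoxodromicSequence f a b) :
    IsLoxodromicSequence (fun n => (f n)⁻¹) b a where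
  ne := h.ne.symm
  smul_left n := inv_smul_eq_iff.2 (h.smul_right n).symm
  smul_right n := inv_smul_eq_iff.2 (h.smul_left n).symm
  tendsto := h.tendsto_inv
  tendsto_inv := by simpa only [inv_inv] using h.tendsto

lemma isPreconnected_compl_left [T1Space M] [LocallyConnectedSpace M]
    [ContinuousConstSMul G M] (h : IsLoxodromicSequence f a b) :
    IsPreconnected ({a}ᶜ : Set M) := by
  set A := connectedComponentIn ({a}ᶜ : Set M) b with hA
  have hbA : b ∈ A := mem_connectedComponentIn h.ne.symm
  have hAo : IsOpen A := isOpen_compl_singleton.connectedComponentIn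
  have hsub : ({a}ᶜ : Set M) ⊆ A := by
    intro y hy
    obtain ⟨n, hn⟩ := ((h.tendsto.tendsto hy).eventually (hAo.mem_nhds hbA)).exists
    have hfA : (f n)⁻¹ • A ⊆ A := by
      refine IsPreconnected.subset_connectedComponentIn
        (isPreconnected_connectedComponentIn.image _
          (continuous_const_smul (f n)⁻¹).continuousOn)
        (mem_smul_set.2 ⟨b, hbA, inv_smul_eq_iff.2 (h.smul_right n).symm⟩) ?_
      rintro _ ⟨z, hz, rfl⟩ hza
      refine connectedComponentIn_subset _ _ hz ?_
      have : z = f n • a := by rw [← inv_smul_eq_iff]; exact hza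
      rw [this, h.smul_left]; rfl
    exact hfA (mem_smul_set_iff_inv_smul_mem.2 (by rwa [inv_inv]))
  rw [hsub.antisymm (connectedComponentIn_subset _ _)]
  exact isPreconnected_connectedComponentIn

end IsLoxodromicSequence

lemma exists_isLoxodromicSequence_of_contraction {G M : Type*} [Group G] [TopologicalSpace M]
    [T2Space M] [CompactSpace M] [MulAction G M] [ContinuousConstSMul G M]
    (hconv : IsConvergenceAction G M) {h : G} {a z : M} {U : Set M} (ha : h • a = a)
    (haU : a ∉ closure U) (hU : h • closure U ⊆ U) (hzU : z ∉ closure U) (hza : z ≠ a)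
    (hz : h • z ∈ U) : ∃ (f : ℕ → G) (b : M), IsLoxodromicSequence f a b := by
  have hpowU : ∀ (k : ℕ) (y : M), y ∈ U → h ^ k • y ∈ U := by
    intro k y hy
    induction k with
    | zero => simpa using hy
    | succ k ih =>
      rw [pow_succ', mul_smul]
      exact hU (smul_mem_smul_set (subset_closure ih))
  have hpowa : ∀ k : ℕ, h ^ k • a = a := by
    intro k
    induction k with
    | zero => simp
    | succ k ih => rw [pow_succ', mul_smul, ih, ha]
  have hinj : Function.Injective fun k : ℕ => h ^ k := by
    rw [injective_pow_iff_not_isOfFinOrder, isOfFinOrder_iff_pow_eq_one]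
    rintro ⟨k, hk, hk1⟩
    obtain ⟨m, rfl⟩ := Nat.exists_eq_succ_of_ne_zero hk.ne'
    have := hpowU m _ hz
    rw [← mul_smul, ← pow_succ, hk1, one_smul] at this
    exact hzU (subset_closure this)
  obtain ⟨p, q, φ, -, hp, hq⟩ := hconv _ hinj
  have hlim : ∀ y ∈ U, y ≠ q → p ∈ closure U := fun y hy hyq =>
    mem_closure_of_tendsto (hp.tendsto hyq) (Eventually.of_forall fun n => hpowU _ y hy)
  have hzz : h • z ≠ h • h • z := fun he => by
    have := smul_left_cancel h he
    exact hzU (subset_closure (this ▸ hz))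
  have hpU : p ∈ closure U := by
    by_cases h1 : h • z = q
    · exact hlim (h • h • z) (hU (smul_mem_smul_set (subset_closure hz)))
        (fun h2 => hzz (h1.trans h2.symm))
    · exact hlim _ hz h1
  have hqa : q = a := by
    by_contra hne
    have h1 := hp.tendsto (Ne.symm hne)
    simp only [hpowa] at h1
    exact haU (tendsto_nhds_unique h1 tendsto_const_nhds ▸ hpU)
  subst hqa
  have hhp : h • p = p := by
    have h1 := (hp.tendsto hza).const_smul h
    have h2 := hp.tendsto (y := h • z) (fun he => hza (smul_left_cancel h (he.trans ha.symm)))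
    refine tendsto_nhds_unique h1 (h2.congr fun n => ?_)
    simp only [← mul_smul, ← pow_succ, ← pow_succ']
  have hpowp : ∀ k : ℕ, h ^ k • p = p := by
    intro k
    induction k with
    | zero => simp
    | succ k ih => rw [pow_succ', mul_smul, ih, hhp]
  exact ⟨_, p, fun he => haU (he ▸ hpU), fun _ => hpowa _, fun _ => hpowp _, hp, hq⟩

lemma IsConicalLimitPoint.exists_locallyUniform {G M : Type*} [Group G] [TopologicalSpace M]
    [T2Space M] [Infinite M] [MulAction G M] (hconv : IsConvergenceAction G M) {x : M}
    (hx : IsConicalLimitPoint G x) :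
    ∃ (g : ℕ → G) (α β : M), α ≠ β ∧ Tendsto (fun n => g n • x) atTop (𝓝 α) ∧
      TendstoLocallyUniformlyAway g β x := by
  obtain ⟨g, α, β, hαβ, hgx, hgy⟩ := hx
  have hrange : (range g).Infinite := by
    intro hfin
    have := hfin.to_subtype
    obtain ⟨v, hv⟩ := Finite.exists_infinite_fiber (rangeFactorization g)
    have hfreq : ∃ᶠ n in atTop, g n = v := by
      rw [Nat.frequently_atTop_iff_infinite]
      convert Set.infinite_coe_iff.1 hv using 1
      ext n
      simp [Subtype.ext_iff]
    have hconst : ∀ y ≠ x, (v : G) • y = β := by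
      intro y hy
      by_contra hne
      obtain ⟨n, hn, hn'⟩ :=
        (hfreq.and_eventually ((hgy y hy).eventually_ne (Ne.symm hne))).exists
      exact hn' (by rw [hn])
    obtain ⟨y, hy⟩ := Infinite.exists_notMem_finset ({x} : Finset M)
    classical
    obtain ⟨w, hw⟩ := Infinite.exists_notMem_finset ({x, y} : Finset M)
    simp only [Finset.mem_insert, Finset.mem_singleton, not_or] at hy hw
    exact hw.2 (smul_left_cancel (v : G) ((hconst w hw.1).trans (hconst y hy).symm))
  choose k hk using fun n => (hrange.natEmbedding _ n).2
  have hgk : Function.Injective fun n => g (k n) := fun m n hmn =>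
    (hrange.natEmbedding _).injective (Subtype.ext (by simpa only [hk] using hmn))
  have hkt : Tendsto k atTop atTop :=
    Function.Injective.nat_tendsto_atTop fun m n hmn => hgk (congrArg g hmn)
  obtain ⟨p, q, φ, hφ, hp, -⟩ := hconv _ hgk
  have ht : Tendsto (fun n => k (φ n)) atTop atTop := hkt.comp hφ.tendsto_atTop
  classical
  obtain ⟨y, hy⟩ := Infinite.exists_notMem_finset ({x, q} : Finset M)
  simp only [Finset.mem_insert, Finset.mem_singleton, not_or] at hy
  have hpβ : p = β := tendsto_nhds_unique (hp.tendsto hy.2) ((hgy y hy.1).comp ht)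
  have hqx : q = x := by
    by_contra hne
    exact hαβ ((tendsto_nhds_unique (hp.tendsto (Ne.symm hne)) (hgx.comp ht)).symm.trans hpβ)
  subst hpβ hqx
  exact ⟨_, α, p, hαβ, hgx.comp ht, hp⟩

lemma exists_isLoxodromicSequence_of_frequently_eq {G M : Type*} [Group G] [MetricSpace M]
    [CompactSpace M] [Infinite M] [MulAction G M] [ContinuousConstSMul G M]
    (hconv : IsConvergenceAction G M) {g : ℕ → G} {a α β : M} (hαβ : α ≠ β)
    (hg : TendstoLocallyUniformlyAway g β a) (hfreq : ∃ᶠ n in atTop, g n • a = α) :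
    ∃ (f : ℕ → G) (b : M), IsLoxodromicSequence f a b := by
  classical
  obtain ⟨m, hm⟩ := hfreq.exists
  set β' := (g m)⁻¹ • β with hβ'
  have hβa : β' ≠ a := fun h => hαβ (by rw [← hm, ← h, hβ', smul_inv_smul])
  obtain ⟨z, hz⟩ := Infinite.exists_notMem_finset ({a, β'} : Finset M)
  simp only [Finset.mem_insert, Finset.mem_singleton, not_or] at hz
  set ε := min (dist a β') (dist z β') / 2 with hε
  have hpos : 0 < min (dist a β') (dist z β') :=
    lt_min (dist_pos.2 hβa.symm) (dist_pos.2 hz.2)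
  have hε0 : 0 < ε := half_pos hpos
  have hnot : ∀ y, min (dist a β') (dist z β') ≤ dist y β' →
      y ∉ closure (Metric.ball β' ε) := fun y hy h => by
    have := Metric.mem_closedBall.1 (Metric.closure_ball_subset_closedBall h)
    have := half_lt_self hpos
    linarith
  have haU := hnot a (min_le_left _ _)
  have hzU := hnot z (min_le_right _ _)
  have hK : IsCompact (insert z (closure (Metric.ball β' ε))) :=
    isClosed_closure.isCompact.insert z
  obtain ⟨N, hN⟩ := hg _ hK (by
      rintro y (rfl | hy) rfl
      exacts [hz.1 rfl, haU hy])
    (g m • Metric.ball β' ε) (Metric.isOpen_ball.smul _)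
    (mem_smul_set_iff_inv_smul_mem.2 (Metric.mem_ball_self hε0))
  obtain ⟨n, hna, hn⟩ := (hfreq.and_eventually (eventually_gt_atTop N)).exists
  have hsub := hN n hn
  rw [smul_set_subset_iff_subset_inv_smul_set, ← mul_smul,
    ← inv_inv (g m), ← mul_inv_rev, ← smul_set_subset_iff_subset_inv_smul_set] at hsub
  refine exists_isLoxodromicSequence_of_contraction hconv (h := (g m)⁻¹ * g n) (a := a) (z := z)
    (U := Metric.ball β' ε) ?_ haU ((smul_set_mono (subset_insert _ _)).trans hsub) hzU hz.1
    (hsub (smul_mem_smul_set (mem_insert _ _)))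
  rw [mul_smul, hna, ← hm, inv_smul_smul]

lemma IsExhaustion.monotone {X : Type*} [TopologicalSpace X] {C : ℕ → Set X}
    (hC : IsExhaustion C) : Monotone C :=
  monotone_nat_of_le_succ fun i => (hC.subset_interior i).trans interior_subset

lemma exists_isExhaustion {X : Type*} [MetricSpace X] [CompactSpace X] (a : X) :
    ∃ C : ℕ → Set ({a}ᶜ : Set X), IsExhaustion C := by
  have : LocallyCompactSpace ({a}ᶜ : Set X) :=
    isOpen_compl_singleton.isOpenEmbedding_subtypeVal.locallyCompactSpace
  have : SigmaCompactSpace ({a}ᶜ : Set X) := inferInstance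
  let K : CompactExhaustion ({a}ᶜ : Set X) := default
  exact ⟨K, K.isCompact, fun i => K.subset_interior_succ i, K.iUnion_eq⟩

section Ends

variable {M : Type u} [MetricSpace M] {a : M} {C : ℕ → Set ({a}ᶜ : Set M)}

lemma IsExhaustion.exists_subset_of_isCompact (hC : IsExhaustion C) {L : Set ({a}ᶜ : Set M)}
    (hL : IsCompact L) : ∃ i, L ⊆ C i := by
  obtain ⟨i, hi⟩ := hL.elim_directed_cover (fun i => interior (C i)) (fun i => isOpen_interior)
    (fun y _ => by
      obtain ⟨i, hi⟩ := mem_iUnion.1 (hC.iUnion_eq.symm ▸ mem_univ y : y ∈ ⋃ i, C i)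
      exact mem_iUnion.2 ⟨i + 1, hC.subset_interior i hi⟩)
    (Monotone.directed_le fun i j hij => interior_mono (hC.monotone hij))
  exact ⟨i, hi.trans interior_subset⟩

lemma IsExhaustion.exists_compl_subset [CompactSpace M] (hC : IsExhaustion C) {U : Set M}
    (hU : U ∈ 𝓝 a) : ∃ i, (Subtype.val '' C i)ᶜ ⊆ U := by
  have hcomp : IsCompact ((↑) ⁻¹' (interior U)ᶜ : Set ({a}ᶜ : Set M)) := by
    refine (Topology.IsInducing.subtypeVal.isCompact_preimage_iff ?_).2 ?_
    · rw [Subtype.range_coe]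
      exact compl_subset_compl.2 (singleton_subset_iff.2 (mem_interior_iff_mem_nhds.2 hU))
    · exact isOpen_interior.isClosed_compl.isCompact
  obtain ⟨i, hi⟩ := hC.exists_subset_of_isCompact hcomp
  refine ⟨i, fun y hy => ?_⟩
  by_contra hyU
  have hya : y ≠ a := fun h => hyU (h ▸ mem_of_mem_nhds hU)
  exact hy ⟨⟨y, hya⟩, hi fun h => hyU (interior_subset h), rfl⟩

/-- The `i`-th set of an end of `M ∖ {a}`, as a subset of `M`. -/
def EndsSpace.toSet (E : EndsSpace C) (i : ℕ) : Set M := Subtype.val '' E.1 i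

namespace EndsSpace

variable (E : EndsSpace C)

lemma toSet_antitone : Antitone E.toSet :=
  antitone_nat_of_succ_le fun i => image_mono (E.2.2 i)

lemma isPreconnected_toSet (i : ℕ) : IsPreconnected (E.toSet i) := by
  obtain ⟨x, -, hx⟩ := E.2.1 i
  rw [toSet, hx]
  exact isPreconnected_connectedComponentIn.image _ continuous_subtype_val.continuousOn

lemma toSet_nonempty (i : ℕ) : (E.toSet i).Nonempty := by
  obtain ⟨x, hxC, hx⟩ := E.2.1 i
  exact ⟨x, x, hx ▸ mem_connectedComponentIn hxC, rfl⟩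

lemma toSet_subset (i : ℕ) : E.toSet i ⊆ ({a} ∪ Subtype.val '' C i)ᶜ := by
  obtain ⟨x, -, hx⟩ := E.2.1 i
  rintro _ ⟨y, hy, rfl⟩ (h | ⟨z, hz, hzy⟩)
  · exact y.2 h
  · rw [hx] at hy
    exact connectedComponentIn_subset _ _ hy (Subtype.val_injective hzy ▸ hz)

lemma absorbsIn_toSet (i : ℕ) : AbsorbsIn ({a} ∪ Subtype.val '' C i)ᶜ (E.toSet i) := by
  rintro V hVF hV ⟨_, hzV, z, hz, rfl⟩
  have hVa : V ⊆ range (Subtype.val : ({a}ᶜ : Set M) → M) := by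
    rw [Subtype.range_coe]
    exact fun y hy h => hVF hy (Or.inl h)
  rw [← image_preimage_eq_of_subset hVa] at hV ⊢
  refine image_mono ?_
  obtain ⟨x, -, hx⟩ := E.2.1 i
  rw [hx] at hz ⊢
  exact absorbsIn_connectedComponentIn _ x _
    (fun y hy h => hVF hy (Or.inr ⟨y, h, rfl⟩))
    (Topology.IsInducing.subtypeVal.isPreconnected_image.1 hV) ⟨z, hzV, hz⟩

lemma mem_closure_toSet [CompactSpace M] (hC : IsExhaustion C) (i : ℕ) :
    a ∈ closure (E.toSet i) := by
  refine mem_closure_iff_nhds.2 fun U hU => ?_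
  obtain ⟨j, hj⟩ := hC.exists_compl_subset hU
  obtain ⟨y, hy⟩ := E.toSet_nonempty (max i j)
  exact ⟨y, hj fun h => E.toSet_subset j (E.toSet_antitone (le_max_right i j) hy) (Or.inr h),
    E.toSet_antitone (le_max_left i j) hy⟩

lemma eventually_disjoint_toSet {E E' : EndsSpace C} (h : E ≠ E') :
    ∀ᶠ i in atTop, Disjoint (E.toSet i) (E'.toSet i) := by
  obtain ⟨i, hi⟩ : ∃ i, E.1 i ≠ E'.1 i := by
    by_contra! hall
    exact h (Subtype.ext (funext hall))
  filter_upwards [eventually_ge_atTop i] with j hj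
  refine Disjoint.mono (E.toSet_antitone hj) (E'.toSet_antitone hj) ?_
  refine (disjoint_image_iff Subtype.val_injective).2 (Set.disjoint_left.2 fun y hy hy' => hi ?_)
  obtain ⟨x, -, hx⟩ := E.2.1 i
  obtain ⟨x', -, hx'⟩ := E'.2.1 i
  rw [hx] at hy
  rw [hx'] at hy'
  rw [hx, hx', connectedComponentIn_eq hy, connectedComponentIn_eq hy']

lemma exists_toSet_inter_subset [CompactSpace M] [LocallyConnectedSpace M]
    (hC : IsExhaustion C) {b : M} (hab : a ≠ b) {A : Set M} (hA : AbsorbsIn ({a, b}ᶜ) A)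
    (haA : a ∈ closure A) (hAab : A ⊆ {a, b}ᶜ) :
    ∃ E : EndsSpace C, ∀ i, (E.toSet i ∩ A).Nonempty := by
  have hstep : ∀ (i : ℕ) (D : Set M), a ∈ closure (D ∩ A) →
      ∃ q : ({a}ᶜ : Set M), q ∉ C i ∧ (q : M) ∈ D ∩ A ∧
        a ∈ closure (Subtype.val '' connectedComponentIn (C i)ᶜ q ∩ A) := by
    intro i D hD
    have hKa : (Subtype.val '' C i ∪ {b})ᶜ ∈ 𝓝 a := by
      refine IsOpen.mem_nhds (IsClosed.isOpen_compl (self := ?_)) ?_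
      · exact ((hC.isCompact i).image continuous_subtype_val).isClosed.union isClosed_singleton
      · rintro (⟨y, -, hy⟩ | h)
        exacts [y.2 hy, hab h]
    obtain ⟨V, hVK, hVo, haV, hV⟩ := exists_isOpen_isPreconnected_subset hKa
    obtain ⟨q, hqV, hqDA⟩ := mem_closure_iff.1 hD V hVo haV
    have hqa : q ≠ a := fun h => hAab hqDA.2 (Or.inl h)
    set W := connectedComponentIn (V \ {a}) q with hW
    have hWV : W ⊆ V \ {a} := connectedComponentIn_subset _ _
    have hqW : q ∈ W := mem_connectedComponentIn ⟨hqV, hqa⟩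
    have hWA : W ⊆ A := by
      refine hA W (fun y hy => ?_) isPreconnected_connectedComponentIn ⟨q, hqW, hqDA.2⟩
      rintro (h | h)
      exacts [(hWV hy).2 h, hVK (hWV hy).1 (Or.inr h)]
    have hWr : W ⊆ range (Subtype.val : ({a}ᶜ : Set M) → M) := by
      rw [Subtype.range_coe]
      exact fun y hy h => (hWV hy).2 h
    have hWC : W ⊆ Subtype.val '' connectedComponentIn (C i)ᶜ ⟨q, hqa⟩ := by
      rw [← image_preimage_eq_of_subset hWr]
      refine image_mono (IsPreconnected.subset_connectedComponentIn ?_ hqW ?_)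
      · refine Topology.IsInducing.subtypeVal.isPreconnected_image.1 ?_
        rw [image_preimage_eq_of_subset hWr]
        exact isPreconnected_connectedComponentIn
      · exact fun y hy h => hVK (hWV hy).1 (Or.inl ⟨y, h, rfl⟩)
    refine ⟨⟨q, hqa⟩, fun h => hVK hqV (Or.inl ⟨_, h, rfl⟩), hqDA, ?_⟩
    exact closure_mono (subset_inter hWC hWA)
      (mem_closure_connectedComponentIn_diff_singleton hVo hV haV hqV hqa)
  let P : ℕ → ({a}ᶜ : Set M) → Prop := fun i q => q ∉ C i ∧ (q : M) ∈ A ∧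
    a ∈ closure (Subtype.val '' connectedComponentIn (C i)ᶜ q ∩ A)
  obtain ⟨q₀, hq₀C, hq₀A, hq₀⟩ := hstep 0 univ (by rwa [univ_inter])
  have hnext : ∀ i q, P i q → ∃ q', P (i + 1) q' ∧ q' ∈ connectedComponentIn (C i)ᶜ q := by
    rintro i q ⟨-, -, hq⟩
    obtain ⟨q', hq'C, ⟨⟨y, hy, hyq'⟩, hq'A⟩, hq'⟩ := hstep (i + 1) _ hq
    exact ⟨q', ⟨hq'C, hq'A, hq'⟩, Subtype.val_injective hyq' ▸ hy⟩
  choose! next hnextP hnext using hnext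
  let q : ℕ → ({a}ᶜ : Set M) := fun i => Nat.rec q₀ next i
  have hP : ∀ i, P i (q i) := by
    intro i
    induction i with
    | zero => exact ⟨hq₀C, hq₀A.2, hq₀⟩
    | succ i ih => exact hnextP i _ ih
  refine ⟨⟨fun i => connectedComponentIn (C i)ᶜ (q i), fun i => ⟨q i, (hP i).1, rfl⟩,
    fun i => ?_⟩, fun i => ?_⟩
  · beta_reduce
    rw [connectedComponentIn_eq (hnext i _ (hP i))]
    exact connectedComponentIn_mono _ (compl_subset_compl.2 (hC.monotone i.le_succ))
  · have hi : q i ∈ connectedComponentIn (C i)ᶜ (q i) := mem_connectedComponentIn (hP i).1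
    exact ⟨(q i).1, mem_image_of_mem _ hi, (hP i).2.1⟩

end EndsSpace

/-- The components of `X ∖ {a, b}`. -/
def pairComponents {X : Type*} [TopologicalSpace X] (a b : X) : Set (Set X) :=
  {A | ∃ y ∈ ({a, b}ᶜ : Set X), A = connectedComponentIn {a, b}ᶜ y}

lemma mk_pairComponents {X : Type u} [TopologicalSpace X] (a b : X) :
    Cardinal.mk (pairComponents a b) = numComplementaryComponents X a b := by
  refine (Cardinal.mk_congr (Equiv.ofBijective (fun x : ConnectedComponents ({a, b}ᶜ : Set X) =>
    (⟨Quotient.lift (fun y : ({a, b}ᶜ : Set X) => Subtype.val '' connectedComponent y)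
      (fun y z h => congrArg _ h) x, ?_⟩ : pairComponents a b)) ⟨?_, ?_⟩)).symm
  · induction x using Quotient.inductionOn with
    | h y => exact ⟨y, y.2, (connectedComponentIn_eq_image y.2).symm⟩
  · intro x x' h
    induction x using Quotient.inductionOn with
    | h y =>
    induction x' using Quotient.inductionOn with
    | h z =>
      exact ConnectedComponents.coe_eq_coe.2
        (Subtype.val_injective.image_injective (Subtype.ext_iff.1 h))
  · rintro ⟨_, y, hy, rfl⟩
    exact ⟨ConnectedComponents.mk ⟨y, hy⟩, Subtype.ext (connectedComponentIn_eq_image hy).symm⟩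

lemma smul_compl_singleton_union {G X : Type*} [Group G] [MulAction G X]
    (g : G) (x : X) (K : Set X) :
    g • ({x} ∪ K)ᶜ = ({g • x} ∪ g • K)ᶜ := by
  rw [smul_set_compl, smul_set_union, smul_set_singleton]

section PairComponents

variable {M : Type u} [MetricSpace M] {a b : M}

lemma eq_of_mem_pairComponents {A B : Set M} (hA : A ∈ pairComponents a b)
    (hB : B ∈ pairComponents a b) {y : M} (hyA : y ∈ A) (hyB : y ∈ B) : A = B := by
  obtain ⟨z, -, rfl⟩ := hA
  obtain ⟨w, -, rfl⟩ := hB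
  rw [connectedComponentIn_eq hyA, connectedComponentIn_eq hyB]

lemma subset_of_mem_pairComponents {A : Set M} (hA : A ∈ pairComponents a b) :
    A ⊆ {a, b}ᶜ := by
  obtain ⟨z, -, rfl⟩ := hA
  exact connectedComponentIn_subset _ _

lemma isPreconnected_of_mem_pairComponents {A : Set M} (hA : A ∈ pairComponents a b) :
    IsPreconnected A := by
  obtain ⟨z, -, rfl⟩ := hA
  exact isPreconnected_connectedComponentIn

lemma absorbsIn_of_mem_pairComponents {A : Set M} (hA : A ∈ pairComponents a b) :
    AbsorbsIn {a, b}ᶜ A := by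
  obtain ⟨z, -, rfl⟩ := hA
  exact absorbsIn_connectedComponentIn _ _

lemma pairComponents_comm (a b : M) : pairComponents a b = pairComponents b a := by
  rw [pairComponents, pairComponents, pair_comm]

lemma left_mem_closure_of_mem_pairComponents [LocallyConnectedSpace M]
    (hb : IsPreconnected ({b}ᶜ : Set M)) (hab : a ≠ b) {A : Set M}
    (hA : A ∈ pairComponents a b) : a ∈ closure A := by
  obtain ⟨z, hz, rfl⟩ := hA
  have hset : ({a, b}ᶜ : Set M) = {b}ᶜ \ {a} := by
    ext y
    simp [and_comm]
  rw [hset] at hz ⊢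
  exact mem_closure_connectedComponentIn_diff_singleton isOpen_compl_singleton hb hab hz.1 hz.2

lemma isPreconnected_insert_of_mem_pairComponents [LocallyConnectedSpace M]
    (hb : IsPreconnected ({b}ᶜ : Set M)) (hab : a ≠ b) {A : Set M}
    (hA : A ∈ pairComponents a b) : IsPreconnected (insert a A) :=
  (isPreconnected_of_mem_pairComponents hA).subset_closure (subset_insert _ _)
    (insert_subset (left_mem_closure_of_mem_pairComponents hb hab hA) subset_closure)

lemma not_mutuallySeparate_of_three_le [LocallyConnectedSpace M] {c d : M}
    (ha : IsPreconnected ({a}ᶜ : Set M))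
    (hb : IsPreconnected ({b}ᶜ : Set M)) (hab : a ≠ b)
    (h3 : 3 ≤ numComplementaryComponents M a b) : ¬ MutuallySeparate M a b c d := by
  rintro ⟨⟨hc, hd, -⟩, ⟨hac, -, hne⟩⟩
  rw [← mk_pairComponents] at h3
  obtain ⟨A, hAc, hAd⟩ := Cardinal.exists_ne_ne_of_three_le h3
    (⟨_, c, hc, rfl⟩ : pairComponents a b) ⟨_, d, hd, rfl⟩
  have hsub : insert a (A : Set M) ∪ insert b (A : Set M) ⊆ {c, d}ᶜ := by
    have hA : (A : Set M) ⊆ {c, d}ᶜ := by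
      rintro y hy (rfl | rfl)
      · exact hAc (Subtype.ext (eq_of_mem_pairComponents A.2 ⟨_, hc, rfl⟩ hy
          (mem_connectedComponentIn hc)))
      · exact hAd (Subtype.ext (eq_of_mem_pairComponents A.2 ⟨_, hd, rfl⟩ hy
          (mem_connectedComponentIn hd)))
    refine union_subset (insert_subset hac hA) (insert_subset ?_ hA)
    rintro (rfl | rfl)
    exacts [hc (Or.inr rfl), hd (Or.inr rfl)]
  obtain ⟨y, hyA⟩ : (A : Set M).Nonempty := by
    obtain ⟨_, y, hy, rfl⟩ := A
    exact ⟨y, mem_connectedComponentIn hy⟩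
  have hpre : IsPreconnected (insert a (A : Set M) ∪ insert b (A : Set M)) :=
    (isPreconnected_insert_of_mem_pairComponents hb hab A.2).union y (Or.inr hyA) (Or.inr hyA)
      (isPreconnected_insert_of_mem_pairComponents ha hab.symm (pairComponents_comm a b ▸ A.2))
  exact hne (connectedComponentIn_eq (hpre.subset_connectedComponentIn
    (Or.inl (mem_insert _ _)) hsub (Or.inr (mem_insert _ _))))

lemma finite_pairComponents [CompactSpace M] [LocallyConnectedSpace M]
    (ha : IsPreconnected ({a}ᶜ : Set M)) (hb : IsPreconnected ({b}ᶜ : Set M)) (hab : a ≠ b) :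
    (pairComponents a b).Finite := by
  set r := dist b a / 2 with hr
  have hr0 : 0 < r := half_pos (dist_pos.2 hab.symm)
  have hrb : r < dist b a := half_lt_self (dist_pos.2 hab.symm)
  have hS : Metric.sphere a r ⊆ {a, b}ᶜ := by
    rintro y hy (rfl | rfl)
    · rw [Metric.mem_sphere, dist_self] at hy
      exact hr0.ne hy
    · exact hrb.ne (Metric.mem_sphere.1 hy).symm
  obtain ⟨t, ht⟩ := (isCompact_sphere a r).elim_nhds_subcover
    (fun y => connectedComponentIn {a, b}ᶜ y) (fun y hy =>
      connectedComponentIn_mem_nhds ((toFinite {a, b}).isClosed.isOpen_compl.mem_nhds (hS hy)))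
  refine (t.finite_toSet.image (fun y => connectedComponentIn {a, b}ᶜ y)).subset fun A hA => ?_
  obtain ⟨x, hx, hxA⟩ := mem_closure_iff.1 (left_mem_closure_of_mem_pairComponents hb hab hA)
    _ Metric.isOpen_ball (Metric.mem_ball_self hr0)
  have hbA : b ∈ closure A :=
    left_mem_closure_of_mem_pairComponents ha hab.symm (pairComponents_comm a b ▸ hA)
  obtain ⟨y, hy, hyA⟩ := mem_closure_iff.1 hbA {y | r < dist y a}
    (isOpen_lt continuous_const (by fun_prop)) hrb
  obtain ⟨z, hzA, hzS⟩ := (isPreconnected_of_mem_pairComponents hA).inter_sphere_nonempty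
    hxA hyA (Metric.mem_ball.1 hx).le (le_of_lt hy)
  obtain ⟨w, hwt, hzw⟩ := mem_iUnion₂.1 (ht.2 hzS)
  exact ⟨w, hwt, eq_of_mem_pairComponents ⟨w, hS (ht.1 w hwt), rfl⟩ hA hzw hzA⟩

variable {C : ℕ → Set ({a}ᶜ : Set M)}

lemma EndsSpace.exists_toSet_subset_pairComponent (hC : IsExhaustion C) (hab : a ≠ b)
    (E : EndsSpace C) : ∃ A : pairComponents a b, ∃ i, E.toSet i ⊆ A := by
  obtain ⟨i, hi⟩ := mem_iUnion.1
    (hC.iUnion_eq.symm ▸ mem_univ _ : (⟨b, hab.symm⟩ : ({a}ᶜ : Set M)) ∈ ⋃ i, C i)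
  have hsub : E.toSet i ⊆ {a, b}ᶜ := by
    rintro y hy (h | h)
    · exact E.toSet_subset i hy (Or.inl h)
    · exact E.toSet_subset i hy (Or.inr ⟨_, hi, h.symm⟩)
  obtain ⟨y, hy⟩ := E.toSet_nonempty i
  exact ⟨⟨_, y, hsub hy, rfl⟩, i,
    (E.isPreconnected_toSet i).subset_connectedComponentIn hy hsub⟩

lemma EndsSpace.pairComponent_unique (E : EndsSpace C) {A B : pairComponents a b} {i j : ℕ}
    (hA : E.toSet i ⊆ A) (hB : E.toSet j ⊆ B) : A = B := by
  obtain ⟨y, hy⟩ := E.toSet_nonempty (max i j)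
  exact Subtype.ext (eq_of_mem_pairComponents A.2 B.2
    (hA (E.toSet_antitone (le_max_left i j) hy)) (hB (E.toSet_antitone (le_max_right i j) hy)))

/-- The component of `M ∖ {a, b}` containing an end of `M ∖ {a}`. -/
noncomputable def EndsSpace.pairComponent (hC : IsExhaustion C) (hab : a ≠ b)
    (E : EndsSpace C) : pairComponents a b :=
  (E.exists_toSet_subset_pairComponent hC hab).choose

lemma EndsSpace.exists_toSet_subset (hC : IsExhaustion C) (hab : a ≠ b) (E : EndsSpace C) :
    ∃ i, E.toSet i ⊆ E.pairComponent hC hab :=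
  (E.exists_toSet_subset_pairComponent hC hab).choose_spec

lemma EndsSpace.pairComponent_surjective [CompactSpace M] [LocallyConnectedSpace M]
    (hC : IsExhaustion C) (hab : a ≠ b) (hb : IsPreconnected ({b}ᶜ : Set M)) :
    Function.Surjective (EndsSpace.pairComponent hC hab) := by
  intro A
  obtain ⟨E, hE⟩ := EndsSpace.exists_toSet_inter_subset hC hab
    (absorbsIn_of_mem_pairComponents A.2) (left_mem_closure_of_mem_pairComponents hb hab A.2)
    (subset_of_mem_pairComponents A.2)
  obtain ⟨i, hi⟩ := E.exists_toSet_subset hC hab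
  obtain ⟨y, hy, hyA⟩ := hE i
  exact ⟨E, Subtype.ext
    (eq_of_mem_pairComponents (EndsSpace.pairComponent hC hab E).2 A.2 (hi hy) hyA)⟩

/-- If `A` and `B` are distinct components of `M ∖ {a, b}` missing `c`, then the two ends of
`M ∖ {a}` lying in them are not separated by `c`; by counting, this forces `c = b`. -/
lemma eq_of_valenceEq_of_numComplementaryComponents_eq [CompactSpace M]
    [LocallyConnectedSpace M] {c : M} {n : Cardinal.{u}}
    (ha : IsPreconnected ({a}ᶜ : Set M)) (hb : IsPreconnected ({b}ᶜ : Set M))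
    (hc : IsPreconnected ({c}ᶜ : Set M)) (hab : a ≠ b) (hac : a ≠ c) (hn : 3 ≤ n)
    (hval : valenceEq a n) (hNb : numComplementaryComponents M a b = n)
    (hNc : numComplementaryComponents M a c = n) : c = b := by
  by_contra hcb
  obtain ⟨C, hC⟩ := exists_isExhaustion a
  have hinj : Function.Injective (EndsSpace.pairComponent hC hac) := by
    have : Finite (pairComponents a c) := finite_pairComponents ha hc hac
    have heq : Cardinal.mk (EndsSpace C) = Cardinal.mk (pairComponents a c) := by
      rw [hval C hC, mk_pairComponents, hNc]
    obtain ⟨e⟩ := Cardinal.eq.1 heq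
    have : Finite (EndsSpace C) := Finite.of_equiv _ e.symm
    exact Function.Surjective.injective_of_finite e
      (EndsSpace.pairComponent_surjective hC hac hc)
  have hcab : c ∈ ({a, b}ᶜ : Set M) := by
    rintro (h | h)
    exacts [hac h.symm, hcb h]
  let A₁ : pairComponents a b := ⟨_, c, hcab, rfl⟩
  have hcA₁ : c ∈ (A₁ : Set M) := mem_connectedComponentIn hcab
  have h3 : (3 : Cardinal) ≤ Cardinal.mk (pairComponents a b) := by
    rwa [mk_pairComponents, hNb]
  obtain ⟨A₂, hA₂⟩ := Cardinal.two_le_iff' A₁ |>.1 (le_trans (by norm_num) h3)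
  obtain ⟨A₃, hA₃₁, hA₃₂⟩ : ∃ A₃, A₃ ≠ A₁ ∧ A₃ ≠ A₂ := Cardinal.exists_ne_ne_of_three_le h3 A₁ A₂
  obtain ⟨E₂, hE₂⟩ := EndsSpace.pairComponent_surjective hC hab hb A₂
  obtain ⟨E₃, hE₃⟩ := EndsSpace.pairComponent_surjective hC hab hb A₃
  have hE : E₂ ≠ E₃ := fun h => hA₃₂ (by rw [← hE₂, ← hE₃, h])
  refine hE (hinj ?_)
  have hA : ∀ A : pairComponents a b, A ≠ A₁ → insert b (A : Set M) ⊆ {a, c}ᶜ := by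
    rintro A hA y (rfl | hy) (h | h)
    · exact hab h.symm
    · exact hcb h.symm
    · exact subset_of_mem_pairComponents A.2 hy (Or.inl h)
    · exact hA (Subtype.ext (eq_of_mem_pairComponents A.2 A₁.2 (h ▸ hy) hcA₁))
  have hpre : ∀ A : pairComponents a b, IsPreconnected (insert b (A : Set M)) := fun A =>
    isPreconnected_insert_of_mem_pairComponents ha hab.symm (pairComponents_comm a b ▸ A.2)
  let Z : pairComponents a c := ⟨_, b, hA A₂ hA₂ (mem_insert _ _), rfl⟩
  have key : ∀ (E : EndsSpace C) (A : pairComponents a b), A ≠ A₁ →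
      EndsSpace.pairComponent hC hab E = A → EndsSpace.pairComponent hC hac E = Z := by
    intro E A hA' hEA
    obtain ⟨i, hi⟩ := E.exists_toSet_subset hC hab
    obtain ⟨j, hj⟩ := E.exists_toSet_subset hC hac
    rw [hEA] at hi
    exact E.pairComponent_unique hj ((hi.trans (subset_insert b _)).trans
      ((hpre A).subset_connectedComponentIn (mem_insert _ _) (hA A hA')))
  rw [key E₂ A₂ hA₂ hE₂, key E₃ A₃ hA₃₁ hE₃]

variable [CompactSpace M] [LocallyConnectedSpace M] {G : Type*} [Group G] [MulAction G M]
  [ContinuousConstSMul G M]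

lemma IsLoxodromicSequence.pairComponent_injective {f : ℕ → G}
    (hf : IsLoxodromicSequence f a b) (hC : IsExhaustion C) :
    Function.Injective (EndsSpace.pairComponent hC hf.ne) := by
  intro E E' hEE'
  by_contra hne
  obtain ⟨i₁, hi₁⟩ := E.exists_toSet_subset hC hf.ne
  obtain ⟨i₂, hi₂⟩ := E'.exists_toSet_subset hC hf.ne
  obtain ⟨i, hd, hii₁, hii₂⟩ := ((EndsSpace.eventually_disjoint_toSet hne).and
    ((eventually_ge_atTop i₁).and (eventually_ge_atTop i₂))).exists
  set A := EndsSpace.pairComponent hC hf.ne E with hA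
  have hEA : E.toSet i ⊆ A := (E.toSet_antitone hii₁).trans hi₁
  have hEA' : E'.toSet i ⊆ A := (E'.toSet_antitone hii₂).trans (hEE' ▸ hi₂)
  set K : Set M := Subtype.val '' C i with hKdef
  have hKc : IsCompact K := (hC.isCompact i).image continuous_subtype_val
  have hKa : K ⊆ {a}ᶜ := by
    rintro _ ⟨y, -, rfl⟩
    exact y.2
  let l : Ultrafilter ℕ := hyperfilter ℕ
  have hl : (l : Filter ℕ) ≤ atTop := Nat.hyperfilter_le_atTop
  have hF : ∀ y ∈ ({a, b}ᶜ : Set M), ∃ U ∈ 𝓝 y, ∀ᶠ n in l, U ⊆ f n • ({a} ∪ K)ᶜ := by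
    intro y hy
    simp only [mem_compl_iff, mem_insert_iff, mem_singleton_iff, not_or] at hy
    obtain ⟨U, V, hU, hV, hyU, hbV, hUV⟩ := t2_separation hy.2
    obtain ⟨N, hN⟩ := hf.tendsto K hKc hKa V hV hbV
    refine ⟨U ∩ {a}ᶜ, inter_mem (hU.mem_nhds hyU) (isOpen_compl_singleton.mem_nhds hy.1), ?_⟩
    filter_upwards [hl (eventually_gt_atTop N)] with n hn
    rw [smul_compl_singleton_union, hf.smul_left]
    rintro z ⟨hzU, hza⟩ (h | h)
    · exact hza h
    · exact hUV.notMem_of_mem_left hzU (hN n hn h)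
  set r := dist b a / 2 with hr
  have hr0 : 0 < r := half_pos (dist_pos.2 hf.ne.symm)
  have hrb : r < dist b a := half_lt_self (dist_pos.2 hf.ne.symm)
  have hS : Metric.sphere a r ⊆ {a, b}ᶜ := by
    rintro y hy (rfl | rfl)
    · rw [Metric.mem_sphere, dist_self] at hy
      exact hr0.ne hy
    · exact hrb.ne (Metric.mem_sphere.1 hy).symm
  have hlim : ∀ E₀ : EndsSpace C, ∃ q ∈ ({a, b}ᶜ : Set M), ∀ᶠ n in l, q ∈ f n • E₀.toSet i := by
    intro E₀
    obtain ⟨q, hqS, hq⟩ := exists_mem_setOf_eventually_mem hF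
      (fun n => (E₀.absorbsIn_toSet i).smul (f n)) (isCompact_sphere a r) hS (by
        obtain ⟨y, hy⟩ := E₀.toSet_nonempty i
        have hya : y ≠ a := fun h => E₀.toSet_subset i hy (Or.inl h)
        have hty := (hf.tendsto.tendsto hya).dist (tendsto_const_nhds (x := a))
        filter_upwards [hl (hty.eventually (lt_mem_nhds hrb))] with n hn
        have ha : a ∈ closure (f n • E₀.toSet i) := by
          rw [closure_smul]
          exact mem_smul_set.2 ⟨a, E₀.mem_closure_toSet hC i, hf.smul_left n⟩
        obtain ⟨x, hx, hxT⟩ := mem_closure_iff.1 ha _ Metric.isOpen_ball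
          (Metric.mem_ball_self hr0)
        exact ((E₀.isPreconnected_toSet i).image _
          (continuous_const_smul (f n)).continuousOn).inter_sphere_nonempty hxT
          (smul_mem_smul_set hy) (Metric.mem_ball.1 hx).le hn.le)
    exact ⟨q, hS hqS, hq⟩
  have habs : ∀ E₀ : EndsSpace C, AbsorbsIn {a, b}ᶜ {y | ∀ᶠ n in l, y ∈ f n • E₀.toSet i} :=
    fun E₀ => absorbsIn_setOf_eventually_mem hF fun n => (E₀.absorbsIn_toSet i).smul (f n)
  obtain ⟨q, hq, hqE⟩ := hlim E
  obtain ⟨q', hq', hqE'⟩ := hlim E'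
  obtain ⟨n, hn, hn'⟩ := (hqE.and hqE').exists
  have hfA : f n • (A : Set M) ⊆ {a, b}ᶜ := by
    rintro _ ⟨y, hy, rfl⟩ (h | h)
    · exact subset_of_mem_pairComponents A.2 hy
        (Or.inl (smul_left_cancel (f n) (h.trans (hf.smul_left n).symm)))
    · exact subset_of_mem_pairComponents A.2 hy
        (Or.inr (smul_left_cancel (f n) (h.trans (hf.smul_right n).symm)))
  have hfAc : IsPreconnected (f n • (A : Set M)) :=
    (isPreconnected_of_mem_pairComponents A.2).image _
      (continuous_const_smul (f n)).continuousOn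
  have hqA : q ∈ f n • (A : Set M) := smul_set_mono hEA hn
  have hqA' : q' ∈ f n • (A : Set M) := smul_set_mono hEA' hn'
  have h1 := habs E _ hfA hfAc ⟨q, hqA, hqE⟩ hqA
  have h2 := habs E' _ hfA hfAc ⟨q', hqA', hqE'⟩ hqA
  obtain ⟨m, hm, hm'⟩ := (h1.and h2).exists
  exact hd.notMem_of_mem_left (mem_smul_set_iff_inv_smul_mem.1 hm)
    (mem_smul_set_iff_inv_smul_mem.1 hm')

lemma IsLoxodromicSequence.valenceEq {f : ℕ → G} (hf : IsLoxodromicSequence f a b) :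
    valenceEq a (numComplementaryComponents M a b) := by
  intro C hC
  rw [← mk_pairComponents]
  exact Cardinal.mk_congr (Equiv.ofBijective _ ⟨hf.pairComponent_injective hC,
    EndsSpace.pairComponent_surjective hC hf.ne hf.symm.isPreconnected_compl_left⟩)

lemma exists_isLoxodromicSequence [Infinite M] (hconv : IsConvergenceAction G M)
    (ha : IsConicalLimitPoint G a) (hval : valenceGe a 3) :
    ∃ (f : ℕ → G) (b : M), IsLoxodromicSequence f a b := by
  obtain ⟨g, α, β, hαβ, hga, hg⟩ := ha.exists_locallyUniform hconv
  refine exists_isLoxodromicSequence_of_frequently_eq hconv hαβ hg ?_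
  obtain ⟨C, hC⟩ := exists_isExhaustion a
  have h3 := hval C hC
  have h3' : Cardinal.mk (ULift.{u} (Fin 3)) ≤ Cardinal.mk (EndsSpace C) := by simpa using h3
  obtain ⟨e⟩ := Cardinal.le_def _ _ |>.1 h3'
  let E : Fin 3 → EndsSpace C := fun j => e ⟨j⟩
  have hE : ∀ j k, j ≠ k → E j ≠ E k := fun j k hjk h =>
    hjk (congrArg ULift.down (e.injective h))
  obtain ⟨i, hi⟩ : ∃ i, ∀ j k, j ≠ k → Disjoint ((E j).toSet i) ((E k).toSet i) :=
    (eventually_all.2 fun j => eventually_all.2 fun k => eventually_imp_distrib_left.2 fun hjk =>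
      EndsSpace.eventually_disjoint_toSet (hE j k hjk)).exists
  let l : Ultrafilter ℕ := hyperfilter ℕ
  have hl : (l : Filter ℕ) ≤ atTop := Nat.hyperfilter_le_atTop
  choose c hc using fun j => (E j).toSet_nonempty i
  have hmain : ∀ᶠ n in l, g n • a = α := by
    refine eventually_eq_of_three_components hαβ (hga.mono_left hl)
      (K := fun n => g n • (Subtype.val '' C i)) (T := fun j n => g n • (E j).toSet i)
      (c := fun j n => g n • c j) ?_ ?_ ?_ ?_ ?_ ?_ ?_
    · intro U hU
      obtain ⟨V, hVU, hV, hβV⟩ := mem_nhds_iff.1 hU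
      obtain ⟨N, hN⟩ := hg (Subtype.val '' C i)
        ((hC.isCompact i).image continuous_subtype_val)
        (by rintro _ ⟨y, -, rfl⟩; exact y.2) V hV hβV
      filter_upwards [hl (eventually_gt_atTop N)] with n hn
      exact (hN n hn).trans hVU
    · exact fun j n => ((E j).isPreconnected_toSet i).image _
        (continuous_const_smul (g n)).continuousOn
    · intro j n
      rw [← smul_compl_singleton_union]
      exact ((E j).absorbsIn_toSet i).smul (g n)
    · intro j k hjk n
      exact (disjoint_image_iff (MulAction.injective (g n))).2 (hi j k hjk)
    · intro j n
      rw [closure_smul]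
      exact smul_mem_smul_set ((E j).mem_closure_toSet hC i)
    · exact fun j n => smul_mem_smul_set (hc j)
    · intro j
      exact (hg.tendsto fun h => (E j).toSet_subset i (hc j) (Or.inl h)).mono_left hl
  exact hmain.frequently.filter_mono hl

end PairComponents

end Ends

end Helpers

/-- Let `M` be a Peano continuum and `G` a group acting on `M` as a
geometrically finite convergence group.  Then `M*(3+)` is partitioned by the relation `≈`
into classes each consisting of exactly two points, and no two of these pairs mutually
separate. -/
theorem approxRel_classes_are_pairs_and_do_not_mutually_separate
    {G : Type*} {M : Type u} [Group G] [MetricSpace M] [CompactSpace M] [ConnectedSpace M]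
    [LocallyConnectedSpace M] [MulAction G M]
    (hcont : ContinuousActionOn G M)
    (hgf : IsGeometricallyFinite G M) :
    (∀ a ∈ Mstar3plus G M, ∃ b ∈ Mstar3plus G M, ApproxRel a b ∧
        ∀ c ∈ Mstar3plus G M, ApproxRel a c → c = b) ∧
      ∀ a b c d : M, a ∈ Mstar3plus G M → b ∈ Mstar3plus G M → c ∈ Mstar3plus G M →
        d ∈ Mstar3plus G M → ApproxRel a b → ApproxRel c d →
          ¬ MutuallySeparate M a b c d := by
  have : ContinuousConstSMul G M := ⟨hcont⟩
  refine ⟨fun a ⟨haC, hacut, haval⟩ => ?_, fun a b c d ha hb _ _ hab _ => ?_⟩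
  · have : Nontrivial M := by
      obtain ⟨-, α, β, hαβ, -⟩ := haC
      exact ⟨α, β, hαβ⟩
    have : Infinite M := PreconnectedSpace.infinite
    obtain ⟨f, b, hf⟩ := exists_isLoxodromicSequence hgf.1 haC haval
    have hva := hf.valenceEq
    have hvb := hf.symm.valenceEq
    have hN : numComplementaryComponents M b a = numComplementaryComponents M a b := by
      rw [numComplementaryComponents, numComplementaryComponents, pair_comm]
    rw [hN] at hvb
    have h3 : 3 ≤ numComplementaryComponents M a b := by
      obtain ⟨C, hC⟩ := exists_isExhaustion a
      exact hva C hC ▸ haval C hC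
    have hpa := hf.isPreconnected_compl_left
    have hpb := hf.symm.isPreconnected_compl_left
    refine ⟨b, ⟨?_, not_not.2 hpb, fun C hC => (hvb C hC).symm ▸ h3⟩,
      ⟨hf.ne, _, h3, rfl, hva, hvb⟩, ?_⟩
    · refine ⟨fun n => (f n)⁻¹, b, a, hf.ne.symm, ?_, fun y hy => hf.tendsto_inv.tendsto hy⟩
      simp only [hf.symm.smul_left]
      exact tendsto_const_nhds
    · rintro c ⟨-, hccut, -⟩ ⟨hac, n, hn, hNc, hvn, -⟩
      obtain ⟨C, hC⟩ := exists_isExhaustion a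
      have hNn : numComplementaryComponents M a b = n := (hva C hC).symm.trans (hvn C hC)
      exact eq_of_valenceEq_of_numComplementaryComponents_eq hpa hpb (not_not.1 hccut) hf.ne hac
        hn hvn hNn hNc
  · obtain ⟨hne, n, hn, hN, -⟩ := hab
    exact not_mutuallySeparate_of_three_le (not_not.1 ha.2.1) (not_not.1 hb.2.1) hne (hN ▸ hn)
end

section
/- Let G be a group acting properly and cocompactly by isometries on a metric space Z, and let 𝒜 be a G-invariant, locally finite collection of closed subspaces of Z. Then the stabilizer Stab_G(A) acts cocompactly on A for every A ∈ 𝒜, and the elements of 𝒜 lie in finitely many G-orbits. -/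
open Set Pointwise

/-- Let `G` act properly and cocompactly by isometries on a metric space
`Z`, and let `𝒜` be a `G`-invariant, locally finite collection of closed subspaces of `Z`.
Then for every `A ∈ 𝒜` the stabilizer of `A` acts cocompactly on `A`, and the elements of
`𝒜` lie in finitely many `G`-orbits. -/
theorem stabilizer_cocompact_and_finitely_many_orbits
    {G Z : Type*} [Group G] [MetricSpace Z] [MulAction G Z]
    (hiso : ∀ g : G, Isometry fun z : Z => g • z)
    (hproper : ProperActionOn G Z)
    (hcocompact : CocompactActionOn G Z)
    (𝒜 : Set (Set Z))
    (hclosed : ∀ A ∈ 𝒜, IsClosed A)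
    (hinv : ∀ (g : G), ∀ A ∈ 𝒜, g • A ∈ 𝒜)
    (hlf : ∀ K : Set Z, IsCompact K → {A ∈ 𝒜 | (A ∩ K).Nonempty}.Finite) :
    (∀ A ∈ 𝒜, ∃ K : Set Z, IsCompact K ∧ K ⊆ A ∧
        (⋃ g ∈ {g : G | g • A = A}, g • K) = A) ∧
      ∃ F : Set (Set Z), F.Finite ∧ F ⊆ 𝒜 ∧ ∀ A ∈ 𝒜, ∃ g : G, ∃ B ∈ F, A = g • B := by
  obtain ⟨K, hK, hcover⟩ := hcocompact
  have hex : ∀ z : Z, ∃ g : G, g • z ∈ K := fun z => by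
    obtain ⟨g, hg⟩ := mem_iUnion.1 (hcover.symm ▸ mem_univ z)
    exact ⟨g⁻¹, mem_smul_set_iff_inv_smul_mem.1 hg⟩
  refine ⟨fun A hA => ?_, {B ∈ 𝒜 | (B ∩ K).Nonempty} ∪ {B ∈ 𝒜 | B = ∅}, ?_, ?_, ?_⟩
  · have hchoose : ∀ B : Set Z, ∃ g : G, (∃ h : G, h • A = B) → g • A = B := fun B => by
      by_cases h : ∃ h : G, h • A = B
      · exact ⟨h.choose, fun _ => h.choose_spec⟩
      · exact ⟨1, fun h' => absurd h' h⟩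
    choose t ht using hchoose
    set S : Set (Set Z) := {B ∈ 𝒜 | (B ∩ K).Nonempty} ∩ {B | ∃ h : G, h • A = B}
    have hsub : (⋃ B ∈ S, (t B)⁻¹ • (K ∩ B)) ⊆ A := by
      refine iUnion₂_subset fun B hB => ?_
      rw [← smul_set_subset_smul_set_iff (a := t B), smul_inv_smul, ht B hB.2]
      exact inter_subset_right
    refine ⟨⋃ B ∈ S, (t B)⁻¹ • (K ∩ B), ?_, hsub, ?_⟩
    · refine ((hlf K hK).inter_of_left _).isCompact_biUnion fun B hB => ?_
      exact (hK.inter_right (hclosed B hB.1.1)).image (hiso (t B)⁻¹).continuous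
    · refine Subset.antisymm (iUnion₂_subset fun g hg => ?_) fun a ha => ?_
      · exact (smul_set_mono hsub).trans (mem_ofPred.1 hg).subset
      · obtain ⟨g, hg⟩ := hex a
        have hga : g • a ∈ g • A := smul_mem_smul_set ha
        have htg : t (g • A) • A = g • A := ht _ ⟨g, rfl⟩
        refine mem_iUnion₂.2 ⟨g⁻¹ * t (g • A), ?_, ?_⟩
        · rw [mem_ofPred, mul_smul, htg, inv_smul_smul]
        · rw [mem_smul_set_iff_inv_smul_mem, mul_inv_rev, inv_inv, mul_smul]
          exact mem_iUnion₂.2 ⟨g • A, ⟨⟨hinv g A hA, _, hga, hg⟩, g, rfl⟩,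
            smul_mem_smul_set ⟨hg, hga⟩⟩
  · exact (hlf K hK).union ((finite_singleton ∅).subset fun B hB => hB.2)
  · exact union_subset (sep_subset _ _) (sep_subset _ _)
  · intro A hA
    rcases A.eq_empty_or_nonempty with h | ⟨a, ha⟩
    · exact ⟨1, A, Or.inr ⟨hA, h⟩, (one_smul G A).symm⟩
    · obtain ⟨g, hg⟩ := hex a
      exact ⟨g⁻¹, g • A, Or.inl ⟨hinv g A hA, _, smul_mem_smul_set ha, hg⟩,
        (inv_smul_smul g A).symm⟩
end
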